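/- KL divergence between Gaussians with prior/posterior structure: if the posterior X|y is N(x̂, Γ_post) and the prior is N(x_pr, Γ_pr), both nondegenerate on ℝⁿ, then the expected Kullback–Leibler divergence of the prior from the posterior over the marginal distribution of Y equals (1/2)(log det Γ_pr − log det Γ_post) whenever the expectation over Y of the quadratic cross terms vanishes; in particular, for the linear Gaussian model Y = R X + N with X ~ N(x_pr, Γ_pr) and N ~ N(0, Γ_noise) independent, E^Y[D_KL(X|Y ‖ X)] = (1/2)(log det Γ_pr − log det Γ_post) where Γ_post = (Γ_pr⁻¹ + Rᵀ Γ_noise⁻¹ R)⁻¹. -/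

import Mathlib

open Matrix MeasureTheory

noncomputable def gp (t : ℝ) : ℝ := ProbabilityTheory.gaussianPDFReal 0 1 t

lemma gp_eq (t : ℝ) : gp t = (2 * Real.pi) ^ (-(1:ℝ)/2) * Real.exp (-(1/2) * t^2) := by
  unfold gp ProbabilityTheory.gaussianPDFReal
  rw [Real.sqrt_eq_rpow, ← Real.rpow_neg (by simp; positivity)]
  norm_num
  left
  ring

lemma gp_int0 : Integrable gp := ProbabilityTheory.integrable_gaussianPDFReal 0 1
lemma gp_int1 : Integrable (fun t => t * gp t) := by
  have h := (integrable_rpow_mul_exp_neg_mul_sq (b := 1/2) (by norm_num) (s := 1) (by norm_num)).const_mul ((2 * Real.pi) ^ (-(1:ℝ)/2))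
  refine h.congr (ae_of_all _ fun t => ?_)
  simp only [gp_eq, Real.rpow_one]
  ring
lemma gp_int2 : Integrable (fun t => t * t * gp t) := by
  have h := (integrable_rpow_mul_exp_neg_mul_sq (b := 1/2) (by norm_num) (s := 2) (by norm_num)).const_mul ((2 * Real.pi) ^ (-(1:ℝ)/2))
  refine h.congr (ae_of_all _ fun t => ?_)
  simp only [gp_eq, Real.rpow_two]
  ring
lemma gp_0 : ∫ t, gp t = 1 := ProbabilityTheory.integral_gaussianPDFReal_eq_one 0 (by norm_num)
lemma gp_1 : ∫ t, t * gp t = 0 := by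
  have h := ProbabilityTheory.integral_id_gaussianReal (μ := 0) (v := 1)
  rw [ProbabilityTheory.integral_gaussianReal_eq_integral_smul (by norm_num)] at h
  rw [← h]
  congr 1; ext t; simp [gp, mul_comm]
lemma gp_2 : ∫ t, t * t * gp t = 1 := by
  have h := ProbabilityTheory.variance_fun_id_gaussianReal (μ := 0) (v := 1)
  rw [ProbabilityTheory.variance_eq_integral measurable_id'.aemeasurable,
    ProbabilityTheory.integral_id_gaussianReal,
    ProbabilityTheory.integral_gaussianReal_eq_integral_smul (by norm_num)] at h
  rw [show (1:ℝ) = ((1:NNReal):ℝ) by simp, ← h]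
  congr 1; ext t; simp [gp]; ring

noncomputable def gP {k : ℕ} (z : Fin k → ℝ) : ℝ := ∏ l, gp (z l)

lemma gP_0 {k : ℕ} : Integrable (gP (k := k)) ∧ ∫ z, gP (k := k) z = 1 := by
  constructor
  · exact Integrable.fintype_prod (f := fun _ => gp) (fun _ => gp_int0)
  · unfold gP
    rw [integral_fintype_prod_volume_eq_prod (fun _ => gp)]
    simp [gp_0]

noncomputable def f1 {k : ℕ} (i l : Fin k) (t : ℝ) : ℝ := (if l = i then t else 1) * gp t
noncomputable def f2 {k : ℕ} (i j l : Fin k) (t : ℝ) : ℝ :=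
  (if l = i then t else 1) * (if l = j then t else 1) * gp t

lemma gP_1 {k : ℕ} (i : Fin k) :
    Integrable (fun z : Fin k → ℝ => z i * gP z) ∧ ∫ z : Fin k → ℝ, z i * gP z = 0 := by
  have e : (fun z : Fin k → ℝ => z i * gP z) =
      fun z => ∏ l, f1 i l (z l) := by
    ext z
    simp only [Finset.prod_mul_distrib, gP, f1, f2, Finset.prod_ite_eq', Finset.mem_univ, if_true]
  rw [e]
  constructor
  · refine Integrable.fintype_prod (fun l => ?_)
    unfold f1
    by_cases h : l = i
    · simpa [h] using gp_int1
    · simpa [h] using gp_int0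
  · rw [integral_fintype_prod_volume_eq_prod (f1 i)]
    apply Finset.prod_eq_zero (Finset.mem_univ i)
    simpa [f1] using gp_1

lemma gP_2 {k : ℕ} (i j : Fin k) :
    Integrable (fun z : Fin k → ℝ => z i * z j * gP z) ∧
      ∫ z : Fin k → ℝ, z i * z j * gP z = if i = j then 1 else 0 := by
  have e : (fun z : Fin k → ℝ => z i * z j * gP z) =
      fun z => ∏ l, f2 i j l (z l) := by
    ext z
    simp only [Finset.prod_mul_distrib, gP, f1, f2, Finset.prod_ite_eq', Finset.mem_univ, if_true]
  rw [e]
  constructor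
  · refine Integrable.fintype_prod (fun l => ?_)
    unfold f2
    by_cases h : l = i <;> by_cases h' : l = j
    · simpa only [if_pos h', if_pos h] using gp_int2
    · simpa only [if_neg h', if_pos h, mul_one] using gp_int1
    · simpa only [if_neg h, if_pos h', one_mul] using gp_int1
    · simpa only [if_neg h, if_neg h', one_mul] using gp_int0
  · rw [integral_fintype_prod_volume_eq_prod (f2 i j)]
    split_ifs with h
    · subst h
      apply Finset.prod_eq_one
      intro l _
      by_cases h : l = i
      · simpa [f2, h] using gp_2
      · simpa [f2, h] using gp_0
    · apply Finset.prod_eq_zero (Finset.mem_univ i)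
      simpa [f2, h] using gp_1

lemma gP_quad {k : ℕ} (c : ℝ) (b : Fin k → ℝ) (A : Matrix (Fin k) (Fin k) ℝ) :
    ∫ z, (c + b ⬝ᵥ z + z ⬝ᵥ A *ᵥ z) * gP z = c + A.trace := by
  have e : (fun z => (c + b ⬝ᵥ z + z ⬝ᵥ A *ᵥ z) * gP z) = fun z =>
      (c * gP z + ∑ i, b i * (z i * gP z)) + ∑ i, ∑ j, A i j * (z i * z j * gP z) := by
    ext z
    simp only [dotProduct, mulVec, add_mul, Finset.sum_mul, Finset.mul_sum]
    congr 1
    · congr 1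
      refine Finset.sum_congr rfl fun i _ => by ring
    · refine Finset.sum_congr rfl fun i _ => Finset.sum_congr rfl fun j _ => by ring
  have i0 : Integrable (fun z : Fin k → ℝ => c * gP z) := gP_0.1.const_mul c
  have i1 : ∀ i, Integrable (fun z : Fin k → ℝ => b i * (z i * gP z)) :=
    fun i => (gP_1 i).1.const_mul _
  have i2 : ∀ i j, Integrable (fun z : Fin k → ℝ => A i j * (z i * z j * gP z)) :=
    fun i j => (gP_2 i j).1.const_mul _
  have i1s := integrable_finsetSum Finset.univ (fun i _ => i1 i)
  have i2s := fun i => integrable_finsetSum Finset.univ (fun j _ => i2 i j)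
  have i2ss := integrable_finsetSum Finset.univ (fun i _ => i2s i)
  have i01 : Integrable (fun z : Fin k → ℝ => c * gP z + ∑ i, b i * (z i * gP z)) := i0.add i1s
  rw [e, integral_add i01 i2ss, integral_add i0 i1s,
    integral_finsetSum _ (fun i _ => i1 i), integral_finsetSum _ (fun i _ => i2s i)]
  simp_rw [fun i => integral_finsetSum Finset.univ (fun j _ => i2 i j), integral_const_mul,
    (gP_1 _).2, (gP_2 _ _).2, gP_0.2]
  simp [trace]

lemma gP_eq {k : ℕ} (z : Fin k → ℝ) :
    gP z = (2 * Real.pi) ^ (-(k:ℝ)/2) * Real.exp (-(1/2) * (z ⬝ᵥ z)) := by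
  unfold gP
  simp_rw [gp_eq, Finset.prod_mul_distrib, ← Real.exp_sum, Finset.prod_const, ← Finset.mul_sum]
  rw [← Real.rpow_natCast, ← Real.rpow_mul (by positivity)]
  simp only [dotProduct, sq, Finset.card_univ, Fintype.card_fin]
  congr 2
  ring

lemma posdef_fact {k : ℕ} {S : Matrix (Fin k) (Fin k) ℝ} (hS : S.PosDef) :
    ∃ L : Matrix (Fin k) (Fin k) ℝ, S = L * Lᵀ := by
  open scoped MatrixOrder ComplexOrder in
  obtain ⟨B, hB⟩ := CStarAlgebra.nonneg_iff_eq_star_mul_self.mp hS.posSemidef.nonneg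
  exact ⟨Bᵀ, by rw [hB]; simp [star_eq_conjTranspose]⟩

lemma gauss_quad {k : ℕ} {S : Matrix (Fin k) (Fin k) ℝ} (hS : S.PosDef) (μ : Fin k → ℝ)
    (c : ℝ) (b : Fin k → ℝ) (A : Matrix (Fin k) (Fin k) ℝ) :
    ∫ x, (c + b ⬝ᵥ (x - μ) + (x - μ) ⬝ᵥ A *ᵥ (x - μ)) *
      ((2 * Real.pi) ^ (-(k : ℝ) / 2) * S.det ^ (-(1 : ℝ) / 2) *
        Real.exp (-(1 / 2) * ((x - μ) ⬝ᵥ S⁻¹ *ᵥ (x - μ)))) = c + (A * S).trace := by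
  rw [integral_sub_right_eq_self (fun x => (c + b ⬝ᵥ x + x ⬝ᵥ A *ᵥ x) *
      ((2 * Real.pi) ^ (-(k : ℝ) / 2) * S.det ^ (-(1 : ℝ) / 2) *
        Real.exp (-(1 / 2) * (x ⬝ᵥ S⁻¹ *ᵥ x)))) μ]
  obtain ⟨L, hL⟩ := posdef_fact hS
  have hdS := hS.det_pos
  have hd : S.det = L.det ^ 2 := by rw [hL, det_mul, det_transpose]; ring
  have hL0 : L.det ≠ 0 := by
    intro h; rw [hd, h] at hdS; simp at hdS
  have hLu : IsUnit L.det := isUnit_iff_ne_zero.mpr hL0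
  have hLtu : IsUnit Lᵀ.det := by rwa [det_transpose]
  have hdd : S.det ^ (-(1 : ℝ) / 2) = |L.det|⁻¹ := by
    rw [hd, ← sq_abs, ← Real.rpow_natCast, ← Real.rpow_mul (abs_nonneg _), ← Real.rpow_neg_one]
    norm_num
  have hinv : Lᵀ * S⁻¹ * L = 1 := by
    rw [hL, Matrix.mul_inv_rev, ← Matrix.mul_assoc, Matrix.mul_nonsing_inv _ hLtu, Matrix.one_mul,
      Matrix.nonsing_inv_mul _ hLu]
  have hquad : ∀ (B : Matrix (Fin k) (Fin k) ℝ) (z : Fin k → ℝ),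
      (L *ᵥ z) ⬝ᵥ B *ᵥ (L *ᵥ z) = z ⬝ᵥ (Lᵀ * B * L) *ᵥ z := by
    intro B z
    rw [← vecMul_transpose L z, ← dotProduct_mulVec, vecMul_transpose]
    simp only [Matrix.mulVec_mulVec, Matrix.mul_assoc]
  have key := gP_quad c (Lᵀ *ᵥ b) (Lᵀ * A * L)
  have htr : (Lᵀ * A * L).trace = (A * S).trace := by
    rw [hL, Matrix.mul_assoc, Matrix.trace_mul_comm, Matrix.mul_assoc]
  rw [← htr, ← key]
  set F : (Fin k → ℝ) → ℝ := fun x => (c + b ⬝ᵥ x + x ⬝ᵥ A *ᵥ x) *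
      ((2 * Real.pi) ^ (-(k : ℝ) / 2) * S.det ^ (-(1 : ℝ) / 2) *
        Real.exp (-(1 / 2) * (x ⬝ᵥ S⁻¹ *ᵥ x))) with hF
  have hFc : Continuous F := by
    rw [hF]
    fun_prop
  have hm := Real.map_matrix_volume_pi_eq_smul_volume_pi hL0
  have h1 : ∫ x, F x ∂(Measure.map (toLin' L) volume) = ∫ z, F (L *ᵥ z) := by
    rw [integral_map (by fun_prop) hFc.aestronglyMeasurable]
    simp
  rw [hm, integral_smul_measure, ENNReal.toReal_ofReal (abs_nonneg _)] at h1
  have h2 : ∫ x, F x = |L.det| * ∫ z, F (L *ᵥ z) := by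
    rw [← h1, abs_inv, smul_eq_mul, mul_inv_cancel_left₀ (abs_ne_zero.mpr hL0)]
  rw [h2, ← integral_const_mul]
  congr 1
  ext z
  simp only [hF]
  rw [hquad, hquad, hinv, hdd, gP_eq, one_mulVec, dotProduct_mulVec b, mulVec_transpose]
  field_simp

lemma trace_fact {n m : ℕ} (P : Matrix (Fin n) (Fin n) ℝ)
    (N : Matrix (Fin m) (Fin m) ℝ) (R : Matrix (Fin m) (Fin n) ℝ)
    (hpr : P.PosDef) (hno : N.PosDef) :
    (P⁻¹ + Rᵀ * N⁻¹ * R).PosDef ∧ (R * P * Rᵀ + N).PosDef ∧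
    (P⁻¹ * (P⁻¹ + Rᵀ * N⁻¹ * R)⁻¹).trace +
      ((P * Rᵀ * (R * P * Rᵀ + N)⁻¹)ᵀ * P⁻¹ * (P * Rᵀ * (R * P * Rᵀ + N)⁻¹) *
        (R * P * Rᵀ + N)).trace = n := by
  have h1 : (P⁻¹ + Rᵀ * N⁻¹ * R).PosDef := by
    apply hpr.inv.add_posSemidef
    simpa using hno.inv.posSemidef.conjTranspose_mul_mul_same R
  have h2 : (R * P * Rᵀ + N).PosDef := by
    apply PosDef.posSemidef_add _ hno
    simpa using hpr.posSemidef.mul_mul_conjTranspose_same R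
  refine ⟨h1, h2, ?_⟩
  have hPi : P⁻¹⁻¹ = P := Matrix.nonsing_inv_nonsing_inv _ hpr.det_pos.ne'.isUnit
  have hNi : N⁻¹⁻¹ = N := Matrix.nonsing_inv_nonsing_inv _ hno.det_pos.ne'.isUnit
  have hPP : P⁻¹ * P = 1 := Matrix.nonsing_inv_mul _ hpr.det_pos.ne'.isUnit
  have hPt : Pᵀ = P := by simpa using hpr.isHermitian.eq
  rw [add_mul_mul_inv_eq_sub _ _ _ _ hpr.inv.isUnit hno.inv.isUnit
    (by rw [hNi, hPi, add_comm]; exact h2.isUnit), hPi, hNi, add_comm N]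
  set S := R * P * Rᵀ + N with hS
  have hSS : S⁻¹ * S = 1 := Matrix.nonsing_inv_mul _ h2.det_pos.ne'.isUnit
  have hSt : Sᵀ = S := by simpa using h2.isHermitian.eq
  have e1 : P⁻¹ * (P - P * Rᵀ * S⁻¹ * R * P) = 1 - Rᵀ * (S⁻¹ * (R * P)) := by
    rw [Matrix.mul_sub, hPP]
    simp only [← Matrix.mul_assoc, hPP, Matrix.one_mul]
  have e2 : (P * Rᵀ * S⁻¹)ᵀ * P⁻¹ * (P * Rᵀ * S⁻¹) * S = S⁻¹ * (R * P) * Rᵀ := by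
    rw [Matrix.mul_assoc _ _ S, Matrix.mul_assoc _ _ S, hSS, transpose_mul, transpose_mul,
      transpose_transpose, hPt, transpose_nonsing_inv, hSt, Matrix.mul_one, Matrix.mul_assoc,
      ← Matrix.mul_assoc P⁻¹, hPP, Matrix.one_mul]
  rw [e1, e2, trace_sub, trace_mul_comm (S⁻¹ * (R * P))]
  simp

/-- Expected Kullback--Leibler divergence of the prior from the posterior in the
linear Gaussian model `Y = R X + N` equals `½ (log det Γ_pr - log det Γ_post)`.
All Gaussian densities involved are given explicitly. -/
theorem stmt_16 {n m : ℕ} (Γpr : Matrix (Fin n) (Fin n) ℝ)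
    (Γnoise : Matrix (Fin m) (Fin m) ℝ) (R : Matrix (Fin m) (Fin n) ℝ)
    (hpr : Γpr.PosDef) (hno : Γnoise.PosDef) (xpr : Fin n → ℝ)
    (Γpost : Matrix (Fin n) (Fin n) ℝ)
    (hpost : Γpost = (Γpr⁻¹ + Rᵀ * Γnoise⁻¹ * R)⁻¹)
    (xhat : (Fin m → ℝ) → (Fin n → ℝ))
    (hxhat : ∀ y, xhat y =
      xpr + (Γpr * Rᵀ * (R * Γpr * Rᵀ + Γnoise)⁻¹) *ᵥ (y - R *ᵥ xpr))
    (πpr : (Fin n → ℝ) → ℝ)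
    (hπpr : ∀ x, πpr x =
      (2 * Real.pi) ^ (-(n : ℝ) / 2) * Γpr.det ^ (-(1 : ℝ) / 2) *
        Real.exp (-(1 / 2) * ((x - xpr) ⬝ᵥ Γpr⁻¹ *ᵥ (x - xpr))))
    (πpost : (Fin n → ℝ) → (Fin m → ℝ) → ℝ)
    (hπpost : ∀ x y, πpost x y =
      (2 * Real.pi) ^ (-(n : ℝ) / 2) * Γpost.det ^ (-(1 : ℝ) / 2) *
        Real.exp (-(1 / 2) * ((x - xhat y) ⬝ᵥ Γpost⁻¹ *ᵥ (x - xhat y))))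
    (πY : (Fin m → ℝ) → ℝ)
    (hπY : ∀ y, πY y =
      (2 * Real.pi) ^ (-(m : ℝ) / 2) * (R * Γpr * Rᵀ + Γnoise).det ^ (-(1 : ℝ) / 2) *
        Real.exp (-(1 / 2) *
          ((y - R *ᵥ xpr) ⬝ᵥ (R * Γpr * Rᵀ + Γnoise)⁻¹ *ᵥ (y - R *ᵥ xpr))))
    (DKL : (Fin m → ℝ) → ℝ)
    (hDKL : ∀ y, DKL y =
      ∫ x : Fin n → ℝ, Real.log (πpost x y / πpr x) * πpost x y) :
    ∫ y : Fin m → ℝ, DKL y * πY y =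
      1 / 2 * (Real.log Γpr.det - Real.log Γpost.det) := by 
  obtain ⟨h1, h2, htr⟩ := trace_fact Γpr Γnoise R hpr hno
  have hpo : Γpost.PosDef := hpost ▸ h1.inv
  rw [← hpost] at htr
  set S := R * Γpr * Rᵀ + Γnoise with hS
  set K := Γpr * Rᵀ * S⁻¹ with hK
  have hD : ∀ y, DKL y = 1 / 2 * (Real.log Γpr.det - Real.log Γpost.det) +
      1 / 2 * ((K *ᵥ (y - R *ᵥ xpr)) ⬝ᵥ Γpr⁻¹ *ᵥ (K *ᵥ (y - R *ᵥ xpr))) +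
      ((1 / 2 : ℝ) • (Γpr⁻¹ - Γpost⁻¹) * Γpost).trace := by
    intro y
    set d := K *ᵥ (y - R *ᵥ xpr) with hd
    rw [hDKL, ← gauss_quad hpo (xhat y) _ ((1 / 2 : ℝ) • (d ᵥ* Γpr⁻¹ + Γpr⁻¹ *ᵥ d)) _]
    congr 1
    ext x
    rw [← hπpost]
    congr 1
    have hx : x - xpr = (x - xhat y) + d := by rw [hxhat]; abel
    have p0 : (2 * Real.pi) ^ (-(n : ℝ) / 2) ≠ 0 := by positivity
    have p1 : Γpr.det ^ (-(1 : ℝ) / 2) ≠ 0 := (Real.rpow_pos_of_pos hpr.det_pos _).ne'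
    have p2 : Γpost.det ^ (-(1 : ℝ) / 2) ≠ 0 := (Real.rpow_pos_of_pos hpo.det_pos _).ne'
    rw [hπpost, hπpr, hx, Real.log_div (by positivity) (by positivity),
      Real.log_mul (by positivity) (by positivity), Real.log_mul (by positivity) (by positivity),
      Real.log_mul (by positivity) (by positivity), Real.log_mul (by positivity) (by positivity),
      Real.log_exp, Real.log_exp, Real.log_rpow hpr.det_pos, Real.log_rpow hpo.det_pos]
    generalize x - xhat y = u
    have q : d ⬝ᵥ Γpr⁻¹ *ᵥ u = (d ᵥ* Γpr⁻¹) ⬝ᵥ u := dotProduct_mulVec _ _ _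
    have q2 : u ⬝ᵥ Γpr⁻¹ *ᵥ d = (Γpr⁻¹ *ᵥ d) ⬝ᵥ u := dotProduct_comm _ _
    simp only [mulVec_add, dotProduct_add, add_dotProduct, smul_dotProduct, smul_mulVec,
      dotProduct_smul, sub_mulVec, dotProduct_sub, smul_eq_mul, q, q2]
    ring
  have key := gauss_quad h2 (R *ᵥ xpr)
    (1 / 2 * (Real.log Γpr.det - Real.log Γpost.det) +
      ((1 / 2 : ℝ) • (Γpr⁻¹ - Γpost⁻¹) * Γpost).trace) 0 ((1 / 2 : ℝ) • (Kᵀ * Γpr⁻¹ * K))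
  have hI : ∫ y : Fin m → ℝ, DKL y * πY y = 1 / 2 * (Real.log Γpr.det - Real.log Γpost.det) +
      ((1 / 2 : ℝ) • (Γpr⁻¹ - Γpost⁻¹) * Γpost).trace +
      (((1 / 2 : ℝ) • (Kᵀ * Γpr⁻¹ * K)) * S).trace := by
    rw [← key]
    congr 1
    ext y
    rw [← hπY, hD]
    congr 1
    generalize y - R *ᵥ xpr = w
    have q : (K *ᵥ w) ⬝ᵥ Γpr⁻¹ *ᵥ (K *ᵥ w) = w ⬝ᵥ (Kᵀ * Γpr⁻¹ * K) *ᵥ w := by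
      rw [← vecMul_transpose K w, ← dotProduct_mulVec, vecMul_transpose]
      simp only [Matrix.mulVec_mulVec, Matrix.mul_assoc]
    rw [q, smul_mulVec, dotProduct_smul, zero_dotProduct, smul_eq_mul]
    ring
  have hpp : Γpost⁻¹ * Γpost = 1 := Matrix.nonsing_inv_mul _ hpo.det_pos.ne'.isUnit
  rw [hI]
  simp only [Matrix.smul_mul, trace_smul, Matrix.sub_mul, trace_sub, hpp, trace_one,
    Fintype.card_fin, smul_eq_mul]
  linarith
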